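/- arXiv:2103.02634 — 2 statements merged into one kernel-verified Lean document; each statement's English description precedes it below -/
import Mathlib

section
/- For every unit vector φ ∈ (ℂ^d)^{⊗n}, the fourth moment of the overlap with a random matrix product state satisfies E_{ψ ∼ μ_{d,n,D}} |⟨ψ|φ⟩|⁴ ≤ 2 · (1 + 1/D)^n (1 + 1/(dD))^n / (d² − 1/D²)^n. -/
/-!
STATEMENT 2: For every unit vector `φ ∈ (ℂ^d)^{⊗n}`, the fourth moment of the overlap
with a random matrix product state satisfies
`E_{ψ ∼ μ_{d,n,D}} |⟨ψ|φ⟩|⁴ ≤ 2 (1 + 1/D)^n (1 + 1/(dD))^n / (d² − 1/D²)^n`.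

The measure `μ_{d,n,D}` is modelled by drawing the `n` site unitaries i.i.d. from the Haar
probability measure on `U(dD)`, i.e. from the unique left-invariant Borel probability
measure on the unitary group.
-/

open MeasureTheory Matrix
open scoped ComplexConjugate

noncomputable section

instance matrixMeasurableSpace {m n : Type*} : MeasurableSpace (Matrix m n ℂ) :=
  MeasurableSpace.pi

/-- The site tensor `A^{(m)}_i = (⟨i| ⊗ 1_D) U (|0⟩ ⊗ 1_D)`. -/
def siteMat (d D : ℕ) [NeZero d] (U : Matrix.unitaryGroup (Fin d × Fin D) ℂ) (i : Fin d) :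
    Matrix (Fin D) (Fin D) ℂ :=
  Matrix.of fun a b => (U : Matrix (Fin d × Fin D) (Fin d × Fin D) ℂ) (i, a) (0, b)

/-- The (unnormalized) matrix product state `ψ`, with periodic boundary conditions:
`ψ(i₁,…,iₙ) = Tr[A^{(1)}_{i₁} ⋯ A^{(n)}_{iₙ}]`. -/
def mps (d D n : ℕ) [NeZero d] (U : Fin n → Matrix.unitaryGroup (Fin d × Fin D) ℂ) :
    (Fin n → Fin d) → ℂ :=
  fun idx => Matrix.trace (((List.finRange n).map fun m => siteMat d D (U m) (idx m)).prod)

theorem path_entry {ι R : Type*} [Fintype ι] [DecidableEq ι] [CommSemiring R] (k : ℕ)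
    (M : Fin (k+1) → Matrix ι ι R) (a b : ι) :
    (((List.finRange (k+1)).map M).prod) a b =
      ∑ p : Fin k → ι, ∏ m, M m ((Fin.cons a p : Fin (k+1) → ι) m)
        ((Fin.snoc p b : Fin (k+1) → ι) m) := by
  induction k generalizing a with
  | zero => simp [List.finRange_succ, Fin.snoc]
  | succ k ih =>
    rw [List.finRange_succ, List.map_cons, List.prod_cons, Matrix.mul_apply, List.map_map]
    rw [← (Fin.consEquiv (fun _ => ι)).sum_comp, Fintype.sum_prod_type]
    refine Finset.sum_congr rfl fun c _ => ?_
    have := ih (fun m => M m.succ) c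
    rw [show (M ∘ Fin.succ) = fun m => M m.succ from rfl, this, Finset.mul_sum]
    refine Finset.sum_congr rfl fun p _ => ?_
    rw [Fin.prod_univ_succ (n := k+1)]
    have h : ∀ m, (Fin.snoc (Fin.cons c p : Fin (k+1) → ι) b : Fin (k+2) → ι) m
        = (Fin.cons c (Fin.snoc p b : Fin (k+1) → ι) : Fin (k+2) → ι) m := by
      intro m; exact (congrFun (Fin.cons_snoc_eq_snoc_cons (β := ι) c p b) m).symm
    simp [Fin.consEquiv, h]

theorem path_trace {ι R : Type*} [Fintype ι] [DecidableEq ι] [CommSemiring R] (k : ℕ)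
    (M : Fin (k+1) → Matrix ι ι R) :
    Matrix.trace (((List.finRange (k+1)).map M).prod) =
      ∑ p : Fin (k+1) → ι, ∏ m, M m (p m) (p (m+1)) := by
  rw [← (Fin.consEquiv (fun _ => ι)).sum_comp, Fintype.sum_prod_type, Matrix.trace]
  refine Finset.sum_congr rfl fun c _ => ?_
  rw [Matrix.diag_apply, path_entry]
  refine Finset.sum_congr rfl fun p _ => Finset.prod_congr rfl fun m _ => ?_
  congr 1
  refine Fin.lastCases ?_ (fun j => ?_) m
  · simp [Fin.consEquiv]
  · simp [Fin.consEquiv]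

def del {α : Type*} [DecidableEq α] (s : Bool) (a b c e : α) : ℂ :=
  if s then (if a = e then 1 else 0) * (if b = c then 1 else 0)
  else (if a = c then 1 else 0) * (if b = e then 1 else 0)

theorem exists_perm_pair {ι : Type*} [DecidableEq ι] (a b a' b' : ι) (h : a ≠ b) (h' : a' ≠ b') :
    ∃ π : Equiv.Perm ι, π a = a' ∧ π b = b' := by
  refine ⟨Equiv.swap (Equiv.swap a a' b) b' * Equiv.swap a a', ?_, ?_⟩
  · simp only [Equiv.Perm.mul_apply, Equiv.swap_apply_left]
    apply Equiv.swap_apply_of_ne_of_ne _ h'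
    intro h2
    have : Equiv.swap a a' a = Equiv.swap a a' b := by simpa using h2
    exact h ((Equiv.swap a a').injective this)
  · simp

def monoMat {ι : Type*} [DecidableEq ι] (π : Equiv.Perm ι) (z : ι → ℂ) : Matrix ι ι ℂ :=
  Matrix.of fun r s => if s = π r then z r else 0

theorem monoMat_mem {ι : Type*} [Fintype ι] [DecidableEq ι] (π : Equiv.Perm ι) (z : ι → ℂ)
    (hz : ∀ r, z r * conj (z r) = 1) : monoMat π z ∈ Matrix.unitaryGroup ι ℂ := by
  rw [Matrix.mem_unitaryGroup_iff]
  ext r t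
  simp only [Matrix.mul_apply, Matrix.star_apply, monoMat, Matrix.of_apply, ite_mul, zero_mul,
    Finset.sum_ite_eq', Finset.sum_ite_eq, Finset.mem_univ, if_true, Matrix.one_apply]
  by_cases h : r = t
  · subst h; simpa using hz r
  · simp [h]

theorem monoMat_sum {ι : Type*} [Fintype ι] [DecidableEq ι] (π : Equiv.Perm ι) (z : ι → ℂ)
    (r : ι) (g : ι → ℂ) : ∑ s, monoMat π z r s * g s = z r * g (π r) := by
  simp [monoMat]

theorem monoMat_sum_conj {ι : Type*} [Fintype ι] [DecidableEq ι] (π : Equiv.Perm ι) (z : ι → ℂ)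
    (r : ι) (g : ι → ℂ) : ∑ s, conj (monoMat π z r s) * g s = conj (z r) * g (π r) := by
  rw [Finset.sum_eq_single (π r)]
  · simp [monoMat]
  · intro b _ hb; simp [monoMat, hb]
  · simp

def hadMat {ι : Type*} [DecidableEq ι] (a b : ι) : Matrix ι ι ℂ :=
  Matrix.of fun r s => if r = a then (if s = a then ((√2 : ℝ) : ℂ)⁻¹ else 0) + (if s = b then ((√2 : ℝ) : ℂ)⁻¹ else 0)
    else if r = b then (if s = a then ((√2 : ℝ) : ℂ)⁻¹ else 0) - (if s = b then ((√2 : ℝ) : ℂ)⁻¹ else 0)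
    else if s = r then 1 else 0

theorem hadMat_sum {ι : Type*} [Fintype ι] [DecidableEq ι] (a b r : ι) (g : ι → ℂ) :
    ∑ s, hadMat a b r s * g s = if r = a then ((√2 : ℝ) : ℂ)⁻¹ * (g a + g b)
      else if r = b then ((√2 : ℝ) : ℂ)⁻¹ * (g a - g b) else g r := by
  simp only [hadMat, Matrix.of_apply]
  split_ifs
  · simp [add_mul, Finset.sum_add_distrib, mul_add]
  · simp [sub_mul, Finset.sum_sub_distrib, mul_sub]
  · simp

theorem hh : ((√2 : ℝ) : ℂ)⁻¹ * ((√2 : ℝ) : ℂ)⁻¹ = 1/2 := by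
  rw [← mul_inv, ← Complex.ofReal_mul, Real.mul_self_sqrt (by norm_num)]; norm_num

theorem hadMat_mem {ι : Type*} [Fintype ι] [DecidableEq ι] (a b : ι) (hab : a ≠ b) :
    hadMat a b ∈ Matrix.unitaryGroup ι ℂ := by
  rw [Matrix.mem_unitaryGroup_iff]
  ext r t
  simp only [Matrix.mul_apply, Matrix.star_apply]
  rw [hadMat_sum]
  simp only [hadMat, Matrix.of_apply, Matrix.one_apply]
  have h1 := hh
  have hc : conj ((√2 : ℝ) : ℂ) = ((√2 : ℝ) : ℂ) := Complex.conj_ofReal _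
  have hab' := hab.symm
  by_cases hra : r = a <;> by_cases hrb : r = b <;> by_cases hta : t = a <;> by_cases htb : t = b <;>
    by_cases hrt : r = t <;>
    simp_all [mul_add, mul_sub] <;> first | done | (norm_num; done) | grind

theorem inv_form {ι : Type*} [Fintype ι] [DecidableEq ι] [Nontrivial ι] (f : ι → ι → ι → ι → ℂ)
    (hf : ∀ V ∈ Matrix.unitaryGroup ι ℂ, ∀ r1 r2 r3 r4, f r1 r2 r3 r4 =
      ∑ s1, V r1 s1 * ∑ s2, V r2 s2 * ∑ s3, conj (V r3 s3) * ∑ s4, conj (V r4 s4) * f s1 s2 s3 s4) :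
    ∃ A B : ℂ, ∀ r1 r2 r3 r4, f r1 r2 r3 r4 =
      A * del false r1 r2 r3 r4 + B * del true r1 r2 r3 r4 := by
  have hperm : ∀ (π : Equiv.Perm ι) r1 r2 r3 r4,
      f r1 r2 r3 r4 = f (π r1) (π r2) (π r3) (π r4) := by
    intro π r1 r2 r3 r4
    rw [hf _ (monoMat_mem π (fun _ => 1) (by simp)) r1 r2 r3 r4]
    simp only [monoMat_sum, monoMat_sum_conj]; simp
  have hdiag : ∀ (j : ι) r1 r2 r3 r4, f r1 r2 r3 r4 =
      (if r1 = j then Complex.I else 1) * ((if r2 = j then Complex.I else 1) *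
      ((if r3 = j then -Complex.I else 1) * ((if r4 = j then -Complex.I else 1) * f r1 r2 r3 r4))) := by
    intro j r1 r2 r3 r4
    conv_lhs => rw [hf _ (monoMat_mem (Equiv.refl _) (fun x => if x = j then Complex.I else 1)
      (by intro r; split_ifs <;> simp)) r1 r2 r3 r4]
    simp only [monoMat_sum, monoMat_sum_conj, apply_ite (conj : ℂ → ℂ), Complex.conj_I, map_one,
      Equiv.refl_apply]
  have key : ∀ x : ℂ, x = Complex.I * x → x = 0 := by
    intro x hx
    have : (1 - Complex.I) * x = 0 := by linear_combination hx
    rcases mul_eq_zero.1 this with h | h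
    · have := congrArg Complex.re h; simp at this
    · exact h
  have hvan : ∀ r1 r2 r3 r4, ¬ (r1 = r3 ∧ r2 = r4) → ¬ (r1 = r4 ∧ r2 = r3) → f r1 r2 r3 r4 = 0 := by
    intro r1 r2 r3 r4 h1 h2
    have hI := Complex.I_mul_I
    by_cases h13 : r1 = r3
    · have h24 : r2 ≠ r4 := fun h => h1 ⟨h13, h⟩
      have := hdiag r2 r1 r2 r3 r4
      subst h13
      rw [if_pos rfl, if_neg h24.symm] at this
      apply key
      split_ifs at this <;> grind
    · by_cases h14 : r1 = r4
      · have h23 : r2 ≠ r3 := fun h => h2 ⟨h14, h⟩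
        have := hdiag r2 r1 r2 r3 r4
        subst h14
        rw [if_pos rfl, if_neg h23.symm] at this
        apply key
        split_ifs at this <;> grind
      · have := hdiag r1 r1 r2 r3 r4
        rw [if_pos rfl, if_neg (Ne.symm h13), if_neg (Ne.symm h14)] at this
        split_ifs at this
        · grind
        · apply key; grind
  obtain ⟨a0, b0, h0⟩ := exists_pair_ne ι
  have hA : ∀ a b, a ≠ b → f a b a b = f a0 b0 a0 b0 := by
    intro a b h
    obtain ⟨π, rfl, rfl⟩ := exists_perm_pair a0 b0 a b h0 h
    exact (hperm π _ _ _ _).symm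
  have hB : ∀ a b, a ≠ b → f a b b a = f a0 b0 b0 a0 := by
    intro a b h
    obtain ⟨π, rfl, rfl⟩ := exists_perm_pair a0 b0 a b h0 h
    exact (hperm π _ _ _ _).symm
  have hC : ∀ a, f a a a a = f a0 b0 a0 b0 + f a0 b0 b0 a0 := by
    intro a
    obtain ⟨b, hb⟩ := exists_ne a
    have h := hf _ (hadMat_mem a b hb.symm) a a a a
    have hreal : ∀ s, conj (hadMat a b a s) = hadMat a b a s := by
      intro s
      simp only [hadMat, Matrix.of_apply, if_true]
      split_ifs <;> simp
    simp only [hreal, hadMat_sum, if_true] at h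
    have hbb : f b b b b = f a a a a := by
      have := hperm (Equiv.swap a b) a a a a
      simpa using this.symm
    have e1 := hA a b hb.symm
    have e2 := hA b a hb
    have e3 := hB a b hb.symm
    have e4 := hB b a hb
    have v : ∀ r1 r2 r3 r4, ¬ (r1 = r3 ∧ r2 = r4) → ¬ (r1 = r4 ∧ r2 = r3) → f r1 r2 r3 r4 = 0 := hvan
    rw [hbb, e1, e2, e3, e4, v a a a b (by simp [hb.symm]) (by simp [hb.symm]),
      v a a b a (by simp [hb.symm]) (by simp [hb.symm]),
      v a a b b (by simp [hb.symm]) (by simp [hb.symm]),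
      v a b a a (by simp [hb]) (by simp [hb]),
      v a b b b (by simp [hb.symm]) (by simp [hb.symm]),
      v b a a a (by simp [hb]) (by simp [hb]),
      v b a b b (by simp [hb.symm]) (by simp [hb.symm]),
      v b b a a (by simp [hb]) (by simp [hb]),
      v b b a b (by simp [hb]) (by simp [hb]),
      v b b b a (by simp [hb]) (by simp [hb])] at h
    have h1 := hh
    grind
  refine ⟨f a0 b0 a0 b0, f a0 b0 b0 a0, fun r1 r2 r3 r4 => ?_⟩
  by_cases h1 : r1 = r3 ∧ r2 = r4
  · obtain ⟨rfl, rfl⟩ := h1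
    by_cases h : r1 = r2
    · subst h; simp [del, hC]
    · simp [del, h, hA _ _ h]
  · by_cases h2 : r1 = r4 ∧ r2 = r3
    · obtain ⟨rfl, rfl⟩ := h2
      have h : r1 ≠ r2 := by rintro rfl; exact h1 ⟨rfl, rfl⟩
      simp [del, h, hB _ _ h]
    · rw [hvan _ _ _ _ h1 h2]
      simp only [del, ← ite_and, mul_ite, mul_one, mul_zero]
      simp
      grind

theorem prod4 {ι : Type*} [Fintype ι] (f1 f2 f3 f4 : ι → ℂ) :
    (∑ s, f1 s) * (∑ s, f2 s) * (∑ s, f3 s) * (∑ s, f4 s) =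
      ∑ s1, ∑ s2, ∑ s3, ∑ s4, f1 s1 * f2 s2 * f3 s3 * f4 s4 := by
  simp only [← Finset.mul_sum, ← Finset.sum_mul]

def mono4 {ι : Type*} [Fintype ι] [DecidableEq ι] (r1 r2 r3 r4 c1 c2 c3 c4 : ι)
    (U : Matrix.unitaryGroup ι ℂ) : ℂ :=
  (U : Matrix ι ι ℂ) r1 c1 * (U : Matrix ι ι ℂ) r2 c2 *
    conj ((U : Matrix ι ι ℂ) r3 c3) * conj ((U : Matrix ι ι ℂ) r4 c4)

theorem meas_entry {ι : Type*} [Fintype ι] [DecidableEq ι] (r c : ι) :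
    Measurable fun U : Matrix.unitaryGroup ι ℂ => (U : Matrix ι ι ℂ) r c :=
  (measurable_pi_apply c).comp ((measurable_pi_apply r).comp measurable_subtype_coe)

theorem meas_mono4 {ι : Type*} [Fintype ι] [DecidableEq ι] (r1 r2 r3 r4 c1 c2 c3 c4 : ι) :
    Measurable (mono4 r1 r2 r3 r4 c1 c2 c3 c4) := by
  have hc : Measurable (conj : ℂ → ℂ) := Complex.continuous_conj.measurable
  exact (((meas_entry _ _).mul (meas_entry _ _)).mul (hc.comp (meas_entry _ _))).mul
    (hc.comp (meas_entry _ _))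

theorem int_mono4 {ι : Type*} [Fintype ι] [DecidableEq ι]
    (μ : Measure (Matrix.unitaryGroup ι ℂ)) [IsProbabilityMeasure μ]
    (r1 r2 r3 r4 c1 c2 c3 c4 : ι) : Integrable (mono4 r1 r2 r3 r4 c1 c2 c3 c4) μ := by
  refine Integrable.of_bound (meas_mono4 ..).aestronglyMeasurable 1 (Filter.Eventually.of_forall ?_)
  intro U
  have h := fun r c => entry_norm_bound_of_unitary U.2 r c
  simp only [mono4, norm_mul, RCLike.norm_conj]
  exact mul_le_one₀ (mul_le_one₀ (mul_le_one₀ (h _ _) (norm_nonneg _) (h _ _)) (norm_nonneg _) (h _ _))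
    (norm_nonneg _) (h _ _)

theorem meas_mulLeft {ι : Type*} [Fintype ι] [DecidableEq ι] (V : Matrix.unitaryGroup ι ℂ) :
    Measurable (fun U => V * U) := by
  refine Measurable.subtype_mk ?_
  refine measurable_pi_iff.2 fun i => measurable_pi_iff.2 fun j => ?_
  simp only [Matrix.mul_apply]
  exact Finset.measurable_sum _ fun k _ => Measurable.const_mul (meas_entry _ _) _

theorem mono4_mul {ι : Type*} [Fintype ι] [DecidableEq ι] (r1 r2 r3 r4 c1 c2 c3 c4 : ι)
    (V U : Matrix.unitaryGroup ι ℂ) :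
    mono4 r1 r2 r3 r4 c1 c2 c3 c4 (V * U) =
      ∑ s1, V.1 r1 s1 * ∑ s2, V.1 r2 s2 * ∑ s3, conj (V.1 r3 s3) * ∑ s4, conj (V.1 r4 s4) *
        mono4 s1 s2 s3 s4 c1 c2 c3 c4 U := by
  simp only [mono4, Submonoid.coe_mul, Matrix.mul_apply, map_sum, map_mul]
  rw [prod4]
  simp only [Finset.mul_sum]
  refine Finset.sum_congr rfl fun _ _ => Finset.sum_congr rfl fun _ _ =>
    Finset.sum_congr rfl fun _ _ => Finset.sum_congr rfl fun _ _ => ?_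
  ring

theorem weingarten {ι : Type*} [Fintype ι] [DecidableEq ι] [Nontrivial ι]
    (μ : Measure (Matrix.unitaryGroup ι ℂ)) [IsProbabilityMeasure μ]
    (hHaar : ∀ V : Matrix.unitaryGroup ι ℂ, μ.map (fun U => V * U) = μ)
    (c1 c2 c3 c4 : ι) :
    ∃ A B : ℂ, ∀ r1 r2 r3 r4, ∫ U, mono4 r1 r2 r3 r4 c1 c2 c3 c4 U ∂μ =
      A * del false r1 r2 r3 r4 + B * del true r1 r2 r3 r4 := by
  apply inv_form
  intro V hV r1 r2 r3 r4
  have h1 : ∫ U, mono4 r1 r2 r3 r4 c1 c2 c3 c4 U ∂μ =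
      ∫ U, mono4 r1 r2 r3 r4 c1 c2 c3 c4 (⟨V, hV⟩ * U) ∂μ := by
    conv_lhs => rw [← hHaar ⟨V, hV⟩]
    exact integral_map (meas_mulLeft _).aemeasurable (meas_mono4 ..).aestronglyMeasurable
  rw [h1]
  simp only [mono4_mul]
  have i4 : ∀ s1 s2 s3 s4, Integrable (fun U => conj (V r4 s4) * mono4 s1 s2 s3 s4 c1 c2 c3 c4 U) μ :=
    fun s1 s2 s3 s4 => (int_mono4 μ _ _ _ _ _ _ _ _).const_mul _
  have i3 : ∀ s1 s2 s3, Integrable (fun U => conj (V r3 s3) * ∑ s4, conj (V r4 s4) * mono4 s1 s2 s3 s4 c1 c2 c3 c4 U) μ :=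
    fun s1 s2 s3 => (integrable_finsetSum _ fun _ _ => i4 _ _ _ _).const_mul _
  have i2 : ∀ s1 s2, Integrable (fun U => (V r2 s2) * ∑ s3, conj (V r3 s3) * ∑ s4, conj (V r4 s4) * mono4 s1 s2 s3 s4 c1 c2 c3 c4 U) μ :=
    fun s1 s2 => (integrable_finsetSum _ fun _ _ => i3 _ _ _).const_mul _
  have i1 : ∀ s1, Integrable (fun U => (V r1 s1) * ∑ s2, (V r2 s2) * ∑ s3, conj (V r3 s3) * ∑ s4, conj (V r4 s4) * mono4 s1 s2 s3 s4 c1 c2 c3 c4 U) μ :=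
    fun s1 => (integrable_finsetSum _ fun _ _ => i2 _ _).const_mul _
  rw [integral_finsetSum _ (fun _ _ => i1 _)]
  refine Finset.sum_congr rfl fun s1 _ => ?_
  rw [integral_const_mul, integral_finsetSum _ (fun _ _ => i2 _ _)]
  congr 1
  refine Finset.sum_congr rfl fun s2 _ => ?_
  rw [integral_const_mul, integral_finsetSum _ (fun _ _ => i3 _ _ _)]
  congr 1
  refine Finset.sum_congr rfl fun s3 _ => ?_
  rw [integral_const_mul, integral_finsetSum _ (fun _ _ => i4 _ _ _ _)]
  congr 1
  refine Finset.sum_congr rfl fun s4 _ => ?_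
  rw [integral_const_mul]

theorem col_orth {ι : Type*} [Fintype ι] [DecidableEq ι] (U : Matrix.unitaryGroup ι ℂ) (c c' : ι) :
    ∑ r, U.1 r c * conj (U.1 r c') = if c = c' then 1 else 0 := by
  have h := congrFun (congrFun (Matrix.mem_unitaryGroup_iff'.1 U.2) c') c
  rw [Matrix.mul_apply, Matrix.one_apply] at h
  simp only [Matrix.star_apply] at h
  simp only [@eq_comm _ c c', ← h]
  exact Finset.sum_congr rfl fun _ _ => mul_comm _ _

def wg (q : ℂ) (s t : Bool) : ℂ := if s = t then 1 / (q ^ 2 - 1) else - 1 / (q * (q ^ 2 - 1))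

theorem weingarten2 {ι : Type*} [Fintype ι] [DecidableEq ι] [Nontrivial ι]
    (μ : Measure (Matrix.unitaryGroup ι ℂ)) [IsProbabilityMeasure μ]
    (hHaar : ∀ V : Matrix.unitaryGroup ι ℂ, μ.map (fun U => V * U) = μ)
    (r1 r2 r3 r4 c1 c2 c3 c4 : ι) :
    ∫ U, mono4 r1 r2 r3 r4 c1 c2 c3 c4 U ∂μ =
      ∑ s, ∑ t, wg (Fintype.card ι) s t * (del s r1 r2 r3 r4 * del t c1 c2 c3 c4) := by
  obtain ⟨A, B, h⟩ := weingarten μ hHaar c1 c2 c3 c4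
  set q : ℂ := ((Fintype.card ι : ℕ) : ℂ) with hq
  have e1 : q ^ 2 * A + q * B = del false c1 c2 c3 c4 := by
    have : ∑ r1, ∑ r2, ∫ U, mono4 r1 r2 r1 r2 c1 c2 c3 c4 U ∂μ = del false c1 c2 c3 c4 := by
      simp_rw [← integral_finsetSum _ (fun _ _ => int_mono4 μ _ _ _ _ _ _ _ _)]
      rw [← integral_finsetSum _ (fun _ _ => integrable_finsetSum _ (fun _ _ => int_mono4 μ _ _ _ _ _ _ _ _))]
      have : ∀ U : Matrix.unitaryGroup ι ℂ, ∑ r1, ∑ r2, mono4 r1 r2 r1 r2 c1 c2 c3 c4 U =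
          del false c1 c2 c3 c4 := by
        intro U
        simp only [del, Bool.false_eq_true, if_false, ← col_orth U, Finset.sum_mul_sum]
        refine Finset.sum_congr rfl fun _ _ => Finset.sum_congr rfl fun _ _ => ?_
        simp only [mono4]; ring
      simp [this]
    rw [← this]
    simp only [h, Finset.sum_add_distrib, ← Finset.mul_sum]
    simp [del, ← hq]
    ring
  have e2 : q * A + q ^ 2 * B = del true c1 c2 c3 c4 := by
    have : ∑ r1, ∑ r2, ∫ U, mono4 r1 r2 r2 r1 c1 c2 c3 c4 U ∂μ = del true c1 c2 c3 c4 := by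
      simp_rw [← integral_finsetSum _ (fun _ _ => int_mono4 μ _ _ _ _ _ _ _ _)]
      rw [← integral_finsetSum _ (fun _ _ => integrable_finsetSum _ (fun _ _ => int_mono4 μ _ _ _ _ _ _ _ _))]
      have : ∀ U : Matrix.unitaryGroup ι ℂ, ∑ r1, ∑ r2, mono4 r1 r2 r2 r1 c1 c2 c3 c4 U =
          del true c1 c2 c3 c4 := by
        intro U
        simp only [del, if_true, ← col_orth U, Finset.sum_mul_sum]
        refine Finset.sum_congr rfl fun _ _ => Finset.sum_congr rfl fun _ _ => ?_
        simp only [mono4]; ring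
      simp [this]
    rw [← this]
    simp only [h, Finset.sum_add_distrib, ← Finset.mul_sum]
    simp [del, ← hq]
    ring
  have hc : 1 < Fintype.card ι := Fintype.one_lt_card
  have q0 : q ≠ 0 := by rw [hq]; exact_mod_cast (by omega)
  have q1 : q ^ 2 - 1 ≠ 0 := by
    rw [sub_ne_zero, hq]; norm_cast; nlinarith
  rw [h]
  simp only [Fintype.sum_bool, wg, if_true, Bool.false_eq_true, Bool.true_eq_false, if_false]
  rw [← e1, ← e2]
  field_simp
  ring

def mix {n : ℕ} {α : Type*} (σ : Fin n → Bool) (x y : Fin n → α) : Fin n → α :=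
  fun m => if σ m then y m else x m

theorem prod_del {n : ℕ} {α : Type*} [DecidableEq α] (σ : Fin n → Bool) (x1 x2 x3 x4 : Fin n → α) :
    ∏ m, del (σ m) (x1 m) (x2 m) (x3 m) (x4 m) =
      (if mix σ x1 x2 = x3 then 1 else 0) * (if mix σ x2 x1 = x4 then 1 else 0) := by
  have h : ∀ m, del (σ m) (x1 m) (x2 m) (x3 m) (x4 m) =
      (if mix σ x1 x2 m = x3 m then 1 else 0) * (if mix σ x2 x1 m = x4 m then 1 else 0) := by
    intro m
    cases hs : σ m <;> simp only [del, mix, hs, if_true, Bool.false_eq_true, if_false]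
    ring
  simp only [h, Finset.prod_mul_distrib, Finset.prod_ite_zero, funext_iff]
  simp

theorem mix_mix {n : ℕ} {α : Type*} (σ : Fin n → Bool) (x y : Fin n → α) :
    mix σ (mix σ x y) (mix σ y x) = x := by
  ext m; simp only [mix]; split_ifs <;> rfl

def mixEquiv {n : ℕ} (α : Type*) (σ : Fin n → Bool) :
    ((Fin n → α) × (Fin n → α)) ≃ ((Fin n → α) × (Fin n → α)) where
  toFun p := (mix σ p.1 p.2, mix σ p.2 p.1)
  invFun p := (mix σ p.1 p.2, mix σ p.2 p.1)
  left_inv p := by simp [mix_mix]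
  right_inv p := by simp [mix_mix]

theorem phys_bound {n : ℕ} {α : Type*} [Fintype α] [DecidableEq α] (σ : Fin n → Bool)
    (c : (Fin n → α) → ℂ) (hc : ∑ x, ‖c x‖ ^ 2 = 1) :
    ‖∑ x1, ∑ x2, ∑ x3, ∑ x4, c x1 * c x2 * conj (c x3) * conj (c x4) *
      ∏ m, del (σ m) (x1 m) (x2 m) (x3 m) (x4 m)‖ ≤ 1 := by
  have h : ∑ x1, ∑ x2, ∑ x3, ∑ x4, c x1 * c x2 * conj (c x3) * conj (c x4) *
      ∏ m, del (σ m) (x1 m) (x2 m) (x3 m) (x4 m) =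
      ∑ p : (Fin n → α) × (Fin n → α), c p.1 * c p.2 * conj (c (mixEquiv α σ p).1) *
        conj (c (mixEquiv α σ p).2) := by
    rw [Fintype.sum_prod_type]
    refine Finset.sum_congr rfl fun x1 _ => Finset.sum_congr rfl fun x2 _ => ?_
    simp [prod_del, mixEquiv, ← mul_assoc]
  rw [h]
  refine (norm_sum_le _ _).trans ?_
  have h1 : ∑ p : (Fin n → α) × (Fin n → α), (‖c p.1‖ * ‖c p.2‖) ^ 2 = 1 := by
    rw [Fintype.sum_prod_type]
    simp only [mul_pow, ← Finset.mul_sum, hc, mul_one]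
  have h2 := (mixEquiv α σ).sum_comp (fun p => (‖c p.1‖ * ‖c p.2‖) ^ 2)
  calc _ ≤ ∑ p : (Fin n → α) × (Fin n → α), ((‖c p.1‖ * ‖c p.2‖) ^ 2 / 2 +
        (‖c (mixEquiv α σ p).1‖ * ‖c (mixEquiv α σ p).2‖) ^ 2 / 2) := by
        refine Finset.sum_le_sum fun p _ => ?_
        simp only [norm_mul, RCLike.norm_conj]
        nlinarith [sq_nonneg (‖c p.1‖ * ‖c p.2‖ -
          ‖c (mixEquiv α σ p).1‖ * ‖c (mixEquiv α σ p).2‖)]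
    _ = 1 := by
        rw [Finset.sum_add_distrib, ← Finset.sum_div, ← Finset.sum_div, h2, h1]; norm_num

theorem sum_pi_prod {n : ℕ} {α R : Type*} [Fintype α] [CommSemiring R] (f : Fin n → α → R) :
    ∑ p : Fin n → α, ∏ m, f m (p m) = ∏ m, ∑ a, f m a := by
  rw [Finset.prod_univ_sum]; simp

def gg (D : ℕ) (s t : Bool) : ℝ := if s = t then (D : ℝ) ^ 2 else D

theorem gg_eq (D : ℕ) (s t : Bool) :
    ∑ a : Fin D, ∑ b, ∑ c, ∑ e, del s a b c e * del t a b c e = (gg D s t : ℂ) := by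
  cases s <;> cases t <;> simp [del, gg, sq, ← ite_and, ite_and]

theorem prod_shift {k : ℕ} (f : Fin (k+1) → ℂ) : ∏ m, f (m+1) = ∏ m, f m :=
  Equiv.prod_comp (Equiv.addRight (1 : Fin (k+1))) f

theorem bond {k D : ℕ} (σ τ : Fin (k+1) → Bool) :
    ∑ p1 : Fin (k+1) → Fin D, ∑ p2 : Fin (k+1) → Fin D, ∑ p3 : Fin (k+1) → Fin D,
      ∑ p4 : Fin (k+1) → Fin D,
      ((∏ m, del (σ m) (p1 m) (p2 m) (p3 m) (p4 m)) *
        ∏ m, del (τ m) (p1 (m+1)) (p2 (m+1)) (p3 (m+1)) (p4 (m+1))) =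
      ∏ m, (gg D (τ m) (σ (m+1)) : ℂ) := by
  have h : ∀ p1 p2 p3 p4 : Fin (k+1) → Fin D, ∏ m, del (σ m) (p1 m) (p2 m) (p3 m) (p4 m) =
      ∏ m, del (σ (m+1)) (p1 (m+1)) (p2 (m+1)) (p3 (m+1)) (p4 (m+1)) := fun p1 p2 p3 p4 =>
    (prod_shift (fun m => del (σ m) (p1 m) (p2 m) (p3 m) (p4 m))).symm
  have h2 : ∀ p1 p2 p3 p4 : Fin (k+1) → Fin D,
      (∏ m, del (σ m) (p1 m) (p2 m) (p3 m) (p4 m)) *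
        ∏ m, del (τ m) (p1 (m+1)) (p2 (m+1)) (p3 (m+1)) (p4 (m+1)) =
      ∏ m, (del (τ (m-1)) (p1 m) (p2 m) (p3 m) (p4 m) * del (σ m) (p1 m) (p2 m) (p3 m) (p4 m)) := by
    intro p1 p2 p3 p4
    rw [h, ← Finset.prod_mul_distrib, ← prod_shift (fun m =>
      del (τ (m-1)) (p1 m) (p2 m) (p3 m) (p4 m) * del (σ m) (p1 m) (p2 m) (p3 m) (p4 m))]
    refine Finset.prod_congr rfl fun m _ => ?_
    simp [mul_comm]
  simp only [h2]
  have e4 : ∀ p1 p2 p3 : Fin (k+1) → Fin D, ∑ p4 : Fin (k+1) → Fin D,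
      ∏ m, (del (τ (m-1)) (p1 m) (p2 m) (p3 m) (p4 m) * del (σ m) (p1 m) (p2 m) (p3 m) (p4 m)) =
      ∏ m, ∑ e, (del (τ (m-1)) (p1 m) (p2 m) (p3 m) e * del (σ m) (p1 m) (p2 m) (p3 m) e) :=
    fun p1 p2 p3 => sum_pi_prod
      (fun m e => del (τ (m-1)) (p1 m) (p2 m) (p3 m) e * del (σ m) (p1 m) (p2 m) (p3 m) e)
  have e3 : ∀ p1 p2 : Fin (k+1) → Fin D, ∑ p3 : Fin (k+1) → Fin D,
      ∏ m, ∑ e, (del (τ (m-1)) (p1 m) (p2 m) (p3 m) e * del (σ m) (p1 m) (p2 m) (p3 m) e) =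
      ∏ m, ∑ c, ∑ e, (del (τ (m-1)) (p1 m) (p2 m) c e * del (σ m) (p1 m) (p2 m) c e) :=
    fun p1 p2 => sum_pi_prod
      (fun m c => ∑ e, del (τ (m-1)) (p1 m) (p2 m) c e * del (σ m) (p1 m) (p2 m) c e)
  have e2 : ∀ p1 : Fin (k+1) → Fin D, ∑ p2 : Fin (k+1) → Fin D,
      ∏ m, ∑ c, ∑ e, (del (τ (m-1)) (p1 m) (p2 m) c e * del (σ m) (p1 m) (p2 m) c e) =
      ∏ m, ∑ b, ∑ c, ∑ e, (del (τ (m-1)) (p1 m) b c e * del (σ m) (p1 m) b c e) :=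
    fun p1 => sum_pi_prod
      (fun m b => ∑ c, ∑ e, del (τ (m-1)) (p1 m) b c e * del (σ m) (p1 m) b c e)
  simp only [e4, e3, e2]
  rw [sum_pi_prod (fun m a => ∑ b, ∑ c, ∑ e, del (τ (m-1)) a b c e * del (σ m) a b c e)]
  simp only [gg_eq]
  rw [← prod_shift (fun m => (gg D (τ (m-1)) (σ m) : ℂ))]
  simp

theorem trace_le (T : Matrix Bool Bool ℝ) (r : ℝ) (h0 : ∀ i j, 0 ≤ T i j)
    (hr : ∀ i, ∑ j, T i j = r) (n : ℕ) : Matrix.trace (T ^ n) ≤ 2 * r ^ n := by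
  have hn : ∀ n : ℕ, (∀ i j, 0 ≤ (T ^ n) i j) ∧ ∀ i, ∑ j, (T ^ n) i j = r ^ n := by
    intro n
    induction n with
    | zero =>
      refine ⟨fun i j => ?_, fun i => ?_⟩
      · simp only [pow_zero, Matrix.one_apply]; split_ifs <;> norm_num
      · simp [Matrix.one_apply]
    | succ n ih =>
      refine ⟨fun i j => ?_, fun i => ?_⟩
      · rw [pow_succ, Matrix.mul_apply]
        exact Finset.sum_nonneg fun l _ => mul_nonneg (ih.1 _ _) (h0 _ _)
      · simp only [pow_succ, Matrix.mul_apply]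
        rw [Finset.sum_comm]
        simp only [← Finset.mul_sum, hr, ← Finset.sum_mul, ih.2]
  obtain ⟨a, b⟩ := hn n
  have b1 := b true
  have b2 := b false
  simp only [Fintype.sum_bool] at b1 b2
  simp only [Matrix.trace, Fintype.sum_bool, Matrix.diag_apply]
  linarith [a true false, a false true]

theorem comb_bound (k : ℕ) (W G : Bool → Bool → ℝ) (r : ℝ) (hW : ∀ s t, 0 ≤ W s t)
    (hG : ∀ s t, 0 ≤ G s t) (hr : ∀ s, ∑ u, ∑ t, W s t * G t u = r) :
    ∑ σ : Fin (k+1) → Bool, ∑ τ : Fin (k+1) → Bool,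
      (∏ m, W (σ m) (τ m)) * ∏ m, G (τ m) (σ (m+1)) ≤ 2 * r ^ (k+1) := by
  have h := trace_le (Matrix.of fun s u => ∑ t, W s t * G t u) r
    (fun i j => by
      rw [Matrix.of_apply]; exact Finset.sum_nonneg fun l _ => mul_nonneg (hW _ _) (hG _ _)) hr (k+1)
  have h2 := path_trace k (fun _ => (Matrix.of fun s u => ∑ t, W s t * G t u))
  simp only [List.map_const', List.length_finRange, List.prod_replicate] at h2
  rw [h2] at h
  refine le_trans (le_of_eq ?_) h
  refine Finset.sum_congr rfl fun σ _ => ?_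
  simp only [← Finset.prod_mul_distrib, Matrix.of_apply]
  exact sum_pi_prod (fun m t => W (σ m) t * G t (σ (m+1)))

theorem sp {α β : Type*} [Fintype α] [Fintype β] (A : α → ℂ) (B : β → ℂ) :
    (∑ x, A x) * (∑ p, B p) = ∑ s : α × β, A s.1 * B s.2 := by
  rw [Finset.sum_mul_sum, Fintype.sum_prod_type]

theorem del_prod {α β : Type*} [DecidableEq α] [DecidableEq β] (s : Bool) (x1 x2 x3 x4 : α)
    (p1 p2 p3 p4 : β) : del s (x1, p1) (x2, p2) (x3, p3) (x4, p4) =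
      del s x1 x2 x3 x4 * del s p1 p2 p3 p4 := by
  cases s <;> simp only [del, Prod.mk.injEq, if_true, Bool.false_eq_true, if_false, ite_and] <;>
    split_ifs <;> simp

theorem del_self {α : Type*} [DecidableEq α] (s : Bool) (a : α) : del s a a a a = 1 := by
  cases s <;> simp [del]

theorem wg_expand {k : ℕ} (q : ℂ) (X Y Z : Fin (k+1) → Bool → ℂ) :
    ∏ m, ∑ s, ∑ t, wg q s t * (X m s * Y m s * Z m t) =
      ∑ σ : Fin (k+1) → Bool, ∑ τ : Fin (k+1) → Bool, (∏ m, wg q (σ m) (τ m)) *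
        ((∏ m, X m (σ m)) * ((∏ m, Y m (σ m)) * ∏ m, Z m (τ m))) := by
  rw [← sum_pi_prod (fun m s => ∑ t, wg q s t * (X m s * Y m s * Z m t))]
  refine Finset.sum_congr rfl fun σ _ => ?_
  rw [← sum_pi_prod (fun m t => wg q (σ m) t * (X m (σ m) * Y m (σ m) * Z m t))]
  refine Finset.sum_congr rfl fun τ _ => ?_
  simp only [Finset.prod_mul_distrib]
  ring

theorem moment_eq (d D k : ℕ) [NeZero d] [Nontrivial (Fin d × Fin D)]
    (μ : Measure (Matrix.unitaryGroup (Fin d × Fin D) ℂ)) [IsProbabilityMeasure μ]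
    (hHaar : ∀ V : Matrix.unitaryGroup (Fin d × Fin D) ℂ, μ.map (fun U => V * U) = μ)
    (c : (Fin (k+1) → Fin d) → ℂ) :
    ((∫ U, ‖∑ x, mps d D (k+1) U x * c x‖ ^ 4 ∂(Measure.pi fun _ : Fin (k+1) => μ) : ℝ) : ℂ) =
      ∑ σ : Fin (k+1) → Bool, ∑ τ : Fin (k+1) → Bool, (∏ m, wg ((d * D : ℕ) : ℂ) (σ m) (τ m)) *
        ((∑ x1, ∑ x2, ∑ x3, ∑ x4, c x1 * c x2 * conj (c x3) * conj (c x4) *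
          ∏ m, del (σ m) (x1 m) (x2 m) (x3 m) (x4 m)) *
        ∏ m, (gg D (τ m) (σ (m+1)) : ℂ)) := by
  rw [← integral_complex_ofReal]
  have hpt : ∀ U : Fin (k+1) → Matrix.unitaryGroup (Fin d × Fin D) ℂ,
      ((‖∑ x, mps d D (k+1) U x * c x‖ ^ 4 : ℝ) : ℂ) =
      ∑ s1 : (Fin (k+1) → Fin d) × (Fin (k+1) → Fin D),
      ∑ s2 : (Fin (k+1) → Fin d) × (Fin (k+1) → Fin D),
      ∑ s3 : (Fin (k+1) → Fin d) × (Fin (k+1) → Fin D),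
      ∑ s4 : (Fin (k+1) → Fin d) × (Fin (k+1) → Fin D),
        c s1.1 * c s2.1 * conj (c s3.1) * conj (c s4.1) *
        ∏ m, mono4 (s1.1 m, s1.2 m) (s2.1 m, s2.2 m) (s3.1 m, s3.2 m) (s4.1 m, s4.2 m)
          (0, s1.2 (m+1)) (0, s2.2 (m+1)) (0, s3.2 (m+1)) (0, s4.2 (m+1)) (U m) := by
    intro U
    have hY : ∑ x, mps d D (k+1) U x * c x = ∑ s : (Fin (k+1) → Fin d) × (Fin (k+1) → Fin D),
        c s.1 * ∏ m, (U m).1 (s.1 m, s.2 m) (0, s.2 (m+1)) := by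
      rw [Fintype.sum_prod_type]
      refine Finset.sum_congr rfl fun x _ => ?_
      rw [mps, path_trace, mul_comm, Finset.mul_sum]
      rfl
    have hn : ∀ z : ℂ, ((‖z‖ ^ 4 : ℝ) : ℂ) = z * z * conj z * conj z := by
      intro z
      have := Complex.mul_conj' z
      push_cast
      linear_combination (-(z * conj z) - (‖z‖ : ℂ) ^ 2) * this
    rw [hn, hY, map_sum, prod4]
    refine Finset.sum_congr rfl fun s1 _ => Finset.sum_congr rfl fun s2 _ =>
      Finset.sum_congr rfl fun s3 _ => Finset.sum_congr rfl fun s4 _ => ?_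
    simp only [mono4, Finset.prod_mul_distrib, map_mul, map_prod]
    ring
  simp only [hpt]
  have i4 : ∀ s1 s2 s3 s4 : (Fin (k+1) → Fin d) × (Fin (k+1) → Fin D), Integrable
      (fun U : Fin (k+1) → Matrix.unitaryGroup (Fin d × Fin D) ℂ =>
        c s1.1 * c s2.1 * conj (c s3.1) * conj (c s4.1) *
        ∏ m, mono4 (s1.1 m, s1.2 m) (s2.1 m, s2.2 m) (s3.1 m, s3.2 m) (s4.1 m, s4.2 m)
          (0, s1.2 (m+1)) (0, s2.2 (m+1)) (0, s3.2 (m+1)) (0, s4.2 (m+1)) (U m))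
      (Measure.pi fun _ : Fin (k+1) => μ) := fun s1 s2 s3 s4 =>
    (Integrable.fintype_prod (f := fun m => mono4 (s1.1 m, s1.2 m) (s2.1 m, s2.2 m)
      (s3.1 m, s3.2 m) (s4.1 m, s4.2 m)
          (0, s1.2 (m+1)) (0, s2.2 (m+1)) (0, s3.2 (m+1)) (0, s4.2 (m+1)))
          (fun m => int_mono4 μ _ _ _ _ _ _ _ _)).const_mul _
  have hint : ∀ s1 s2 s3 s4 : (Fin (k+1) → Fin d) × (Fin (k+1) → Fin D),
      ∫ U : Fin (k+1) → Matrix.unitaryGroup (Fin d × Fin D) ℂ,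
        c s1.1 * c s2.1 * conj (c s3.1) * conj (c s4.1) *
        ∏ m, mono4 (s1.1 m, s1.2 m) (s2.1 m, s2.2 m) (s3.1 m, s3.2 m) (s4.1 m, s4.2 m)
          (0, s1.2 (m+1)) (0, s2.2 (m+1)) (0, s3.2 (m+1)) (0, s4.2 (m+1)) (U m)
      ∂(Measure.pi fun _ : Fin (k+1) => μ) =
      ∑ σ : Fin (k+1) → Bool, ∑ τ : Fin (k+1) → Bool, (∏ m, wg ((d * D : ℕ) : ℂ) (σ m) (τ m)) *
        ((c s1.1 * c s2.1 * conj (c s3.1) * conj (c s4.1) *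
          ∏ m, del (σ m) (s1.1 m) (s2.1 m) (s3.1 m) (s4.1 m)) *
          ((∏ m, del (σ m) (s1.2 m) (s2.2 m) (s3.2 m) (s4.2 m)) *
          ∏ m, del (τ m) (s1.2 (m+1)) (s2.2 (m+1)) (s3.2 (m+1)) (s4.2 (m+1)))) := by
    intro s1 s2 s3 s4
    rw [integral_const_mul, integral_fintype_prod_eq_prod (fun m => mono4 (s1.1 m, s1.2 m)
      (s2.1 m, s2.2 m) (s3.1 m, s3.2 m) (s4.1 m, s4.2 m)
          (0, s1.2 (m+1)) (0, s2.2 (m+1)) (0, s3.2 (m+1)) (0, s4.2 (m+1)))]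
    simp only [weingarten2 μ hHaar, del_prod, del_self, one_mul, Fintype.card_prod, Fintype.card_fin]
    rw [wg_expand _ (fun m s => del s (s1.1 m) (s2.1 m) (s3.1 m) (s4.1 m))
      (fun m s => del s (s1.2 m) (s2.2 m) (s3.2 m) (s4.2 m))
      (fun m s => del s (s1.2 (m+1)) (s2.2 (m+1)) (s3.2 (m+1)) (s4.2 (m+1)))]
    simp only [Finset.mul_sum]
    refine Finset.sum_congr rfl fun σ _ => Finset.sum_congr rfl fun τ _ => ?_
    ring
  rw [integral_finsetSum _ (fun _ _ => integrable_finsetSum _ fun _ _ => integrable_finsetSum _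
    fun _ _ => integrable_finsetSum _ fun _ _ => i4 _ _ _ _)]
  simp_rw [integral_finsetSum _ (fun _ _ => integrable_finsetSum _
    fun _ _ => integrable_finsetSum _ fun _ _ => i4 _ _ _ _)]
  simp_rw [integral_finsetSum _ (fun _ _ => integrable_finsetSum _ fun _ _ => i4 _ _ _ _)]
  simp_rw [integral_finsetSum _ (fun _ _ => i4 _ _ _ _), hint]
  simp only [← bond, sp]
  simp only [Finset.mul_sum]
  have sw : ∀ (S : Type) [Fintype S] (F : S → (Fin (k+1) → Bool) → (Fin (k+1) → Bool) → ℂ),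
      ∑ s, ∑ σ, ∑ τ, F s σ τ = ∑ σ, ∑ τ, ∑ s, F s σ τ := by
    intro S _ F
    rw [Finset.sum_comm]
    exact Finset.sum_congr rfl fun _ _ => Finset.sum_comm
  simp only [sw]

theorem overlap_fourth_moment_bound
    (d D n : ℕ) [NeZero d] (hd : 2 ≤ d) (hD : 2 ≤ D) (hn : 1 ≤ n)
    (μ : Measure (Matrix.unitaryGroup (Fin d × Fin D) ℂ)) [IsProbabilityMeasure μ]
    (hHaar : ∀ V : Matrix.unitaryGroup (Fin d × Fin D) ℂ, μ.map (fun U => V * U) = μ)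
    (φ : (Fin n → Fin d) → ℂ) (hφ : ∑ x, ‖φ x‖ ^ 2 = 1) :
    ∫ U, ‖∑ x, conj (mps d D n U x) * φ x‖ ^ 4 ∂(Measure.pi fun _ : Fin n => μ)
      ≤ 2 * (1 + 1 / (D : ℝ)) ^ n * (1 + 1 / ((d : ℝ) * D)) ^ n
          / ((d : ℝ) ^ 2 - 1 / (D : ℝ) ^ 2) ^ n := by
  obtain ⟨k, rfl⟩ : ∃ k, n = k + 1 := ⟨n - 1, by omega⟩
  haveI : Nontrivial (Fin d) := Fin.nontrivial_iff_two_le.2 hd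
  haveI : Nontrivial (Fin D) := Fin.nontrivial_iff_two_le.2 hD
  have h1 : ∀ U, ‖∑ x, conj (mps d D (k+1) U x) * φ x‖ = ‖∑ x, mps d D (k+1) U x * conj (φ x)‖ := by
    intro U
    rw [← RCLike.norm_conj, map_sum]
    simp
  simp only [h1]
  have hm := moment_eq d D k μ hHaar (fun x => conj (φ x))
  set J := ∫ U, ‖∑ x, mps d D (k+1) U x * conj (φ x)‖ ^ 4 ∂(Measure.pi fun _ : Fin (k+1) => μ) with hJ
  have hd' : (2 : ℝ) ≤ d := by exact_mod_cast hd
  have hD' : (2 : ℝ) ≤ D := by exact_mod_cast hD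
  have hq : (4 : ℝ) ≤ d * D := by nlinarith
  have hgg : ∀ s t, 0 ≤ gg D s t := by intro s t; simp only [gg]; split_ifs <;> positivity
  have hq1 : (0 : ℝ) < ((d : ℝ) * D) ^ 2 - 1 := by nlinarith
  have hwg : ∀ s t, ‖wg ((d * D : ℕ) : ℂ) s t‖ = if s = t then 1 / (((d : ℝ) * D) ^ 2 - 1)
      else 1 / (((d : ℝ) * D) * (((d : ℝ) * D) ^ 2 - 1)) := by
    intro s t
    have e1 : wg ((d * D : ℕ) : ℂ) s t = ((if s = t then 1 / (((d : ℝ) * D) ^ 2 - 1)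
      else - (1 / (((d : ℝ) * D) * (((d : ℝ) * D) ^ 2 - 1))) : ℝ) : ℂ) := by
      simp only [wg]; split_ifs <;> push_cast <;> ring
    rw [e1, Complex.norm_real, Real.norm_eq_abs]
    split_ifs
    · exact abs_of_nonneg (by positivity)
    · rw [abs_neg]; exact abs_of_nonneg (by positivity)
  have hJle : J ≤ ∑ σ : Fin (k+1) → Bool, ∑ τ : Fin (k+1) → Bool,
      (∏ m, ‖wg ((d * D : ℕ) : ℂ) (σ m) (τ m)‖) * ∏ m, gg D (τ m) (σ (m+1)) := by
    refine (Complex.ofReal_re J ▸ Complex.re_le_norm (J : ℂ) : J ≤ ‖(J : ℂ)‖).trans ?_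
    rw [hm]
    refine (norm_sum_le _ _).trans (Finset.sum_le_sum fun σ _ => ?_)
    refine (norm_sum_le _ _).trans (Finset.sum_le_sum fun τ _ => ?_)
    rw [norm_mul, norm_mul, norm_prod, norm_prod]
    refine mul_le_mul_of_nonneg_left ?_ (Finset.prod_nonneg fun _ _ => norm_nonneg _)
    have hp := phys_bound σ (fun x => conj (φ x)) (by simpa using hφ)
    have : ∀ m, ‖((gg D (τ m) (σ (m+1)) : ℝ) : ℂ)‖ = gg D (τ m) (σ (m+1)) := by
      intro m; rw [Complex.norm_real, Real.norm_eq_abs, abs_of_nonneg (hgg _ _)]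
    simp only [this]
    exact mul_le_of_le_one_left (Finset.prod_nonneg fun _ _ => hgg _ _) hp
  have hc := comb_bound k (fun s t => ‖wg ((d * D : ℕ) : ℂ) s t‖) (gg D)
    ((1 + 1 / (D : ℝ)) * (1 + 1 / ((d : ℝ) * D)) / ((d : ℝ) ^ 2 - 1 / (D : ℝ) ^ 2))
    (fun _ _ => norm_nonneg _) hgg (by
      have hne : (d : ℝ) ^ 2 - 1 / (D : ℝ) ^ 2 = (((d : ℝ) * D) ^ 2 - 1) / (D : ℝ) ^ 2 := by
        field_simp
      rw [hne]
      have h0 := hq1.ne'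
      have hd0 : (d : ℝ) ≠ 0 := by positivity
      have hD0 : (D : ℝ) ≠ 0 := by positivity
      generalize hQ : ((d : ℝ) * D) ^ 2 - 1 = Q at *
      intro s
      cases s <;> simp only [Fintype.sum_bool, hwg, gg, if_true, if_false, Bool.false_eq_true,
        Bool.true_eq_false] <;> field_simp <;> ring)
  refine hJle.trans (hc.trans (le_of_eq ?_))
  rw [div_pow, mul_pow]
  ring
end
end

section
/- Second-order Weingarten calculus (two-fold twirl formula): let q ≥ 2 be an integer, let 𝔽 denote the swap operator on ℂ^q ⊗ ℂ^q, and let U be distributed according to the Haar probability measure on the unitary group U(q). Then for every matrix X ∈ M_{q²}(ℂ), E_U [(U ⊗ U) X (U ⊗ U)†] = [(Tr X − Tr(𝔽X)/q) / (q² − 1)] · 1 + [(Tr(𝔽X) − Tr(X)/q) / (q² − 1)] · 𝔽. -/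
open MeasureTheory Matrix
open scoped Kronecker

noncomputable section

/-- The swap operator `𝔽` on `ℂ^q ⊗ ℂ^q`, defined by `𝔽(u ⊗ v) = v ⊗ u`; its matrix
entries are `𝔽_{(a,b),(c,e)} = δ_{a,e} δ_{b,c}`. -/
def swapOp (q : ℕ) : Matrix (Fin q × Fin q) (Fin q × Fin q) ℂ :=
  Matrix.of fun p r => if p.1 = r.2 ∧ p.2 = r.1 then 1 else 0


lemma tw_swap_apply (q : ℕ) (p r : Fin q × Fin q) :
    swapOp q p r = if p = r.swap then 1 else 0 := by
  obtain ⟨a, b⟩ := p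
  obtain ⟨c, d⟩ := r
  simp [swapOp]

lemma tw_swap_mul {q : ℕ} (A : Matrix (Fin q × Fin q) (Fin q × Fin q) ℂ) (p r : Fin q × Fin q) :
    (swapOp q * A) p r = A p.swap r := by
  rw [Matrix.mul_apply, Finset.sum_eq_single p.swap]
  · simp [tw_swap_apply]
  · intro b _ hb
    rw [tw_swap_apply, if_neg, zero_mul]
    rintro rfl
    simp at hb
  · simp

lemma tw_mul_swap {q : ℕ} (A : Matrix (Fin q × Fin q) (Fin q × Fin q) ℂ) (p r : Fin q × Fin q) :
    (A * swapOp q) p r = A p r.swap := by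
  rw [Matrix.mul_apply, Finset.sum_eq_single r.swap]
  · simp [tw_swap_apply]
  · intro b _ hb
    rw [tw_swap_apply, if_neg hb, mul_zero]
  · simp

lemma tw_swap_comm {q : ℕ} (A : Matrix (Fin q) (Fin q) ℂ) :
    swapOp q * (A ⊗ₖ A) = (A ⊗ₖ A) * swapOp q := by
  ext p r
  rw [tw_swap_mul, tw_mul_swap]
  simp [Matrix.kroneckerMap_apply, mul_comm]

/-- reflections -/
lemma tw_refl_mem {q : ℕ} (w : Fin q → ℂ) (c : ℂ) (hw : star w = w) (hc : star c = c)
    (h : c * (w ⬝ᵥ w) = 2) :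
    (1 - c • Matrix.vecMulVec w w) ∈ Matrix.unitaryGroup (Fin q) ℂ := by
  rw [Matrix.mem_unitaryGroup_iff]
  have h1 : star (1 - c • Matrix.vecMulVec w w) = 1 - c • Matrix.vecMulVec w w := by
    rw [star_sub, star_one, star_smul, hc, Matrix.star_eq_conjTranspose,
      Matrix.conjTranspose_vecMulVec, hw]
  rw [h1]
  have h2 : Matrix.vecMulVec w w * Matrix.vecMulVec w w = (w ⬝ᵥ w) • Matrix.vecMulVec w w := by
    rw [Matrix.vecMulVec_mul_vecMulVec]
    ext i j
    simp [Matrix.vecMulVec_apply]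
    ring
  have h3 : (c • Matrix.vecMulVec w w) * (c • Matrix.vecMulVec w w)
      = (2 : ℂ) • (c • Matrix.vecMulVec w w) := by
    rw [Matrix.smul_mul, Matrix.mul_smul, h2, smul_smul, smul_smul, smul_smul, ← h]
    congr 1
    ring
  rw [mul_sub, sub_mul, sub_mul, h3, two_smul]
  simp

lemma tw_perm_mem {q : ℕ} (σ : Equiv.Perm (Fin q)) :
    (Matrix.of fun a b => if a = σ b then (1 : ℂ) else 0) ∈ Matrix.unitaryGroup (Fin q) ℂ := by
  rw [Matrix.mem_unitaryGroup_iff']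
  ext a b
  simp [Matrix.mul_apply, Matrix.star_apply, Matrix.one_apply, eq_comm]

lemma tw_diag_mem {q : ℕ} (i : Fin q) :
    (Matrix.diagonal fun a => if a = i then Complex.I else 1) ∈ Matrix.unitaryGroup (Fin q) ℂ := by
  rw [Matrix.mem_unitaryGroup_iff, Matrix.star_eq_conjTranspose, Matrix.diagonal_conjTranspose,
    Matrix.diagonal_mul_diagonal, ← Matrix.diagonal_one]
  congr 1
  ext a
  by_cases h : a = i <;> simp [h]

def TwComm {q : ℕ} (M : Matrix (Fin q × Fin q) (Fin q × Fin q) ℂ) : Prop :=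
  ∀ V ∈ Matrix.unitaryGroup (Fin q) ℂ, (V ⊗ₖ V) * M = M * (V ⊗ₖ V)

lemma tw_perm {q : ℕ} {M : Matrix (Fin q × Fin q) (Fin q × Fin q) ℂ} (hM : TwComm M)
    (σ : Equiv.Perm (Fin q)) (a b c d : Fin q) :
    M (σ a, σ b) (σ c, σ d) = M (a, b) (c, d) := by
  have h := congrFun (congrFun (hM _ (tw_perm_mem σ)) (σ a, σ b)) (c, d)
  rw [Matrix.mul_apply, Matrix.mul_apply, Finset.sum_eq_single (a, b),
    Finset.sum_eq_single (σ c, σ d)] at h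
  · simpa [Matrix.kroneckerMap_apply] using h.symm
  · rintro ⟨x, y⟩ _ hb
    simp [Matrix.kroneckerMap_apply] at hb ⊢
    tauto
  · simp
  · rintro ⟨x, y⟩ _ hb
    simp [Matrix.kroneckerMap_apply] at hb ⊢
    grind
  · simp

lemma tw_zero {q : ℕ} {M : Matrix (Fin q × Fin q) (Fin q × Fin q) ℂ} (hM : TwComm M)
    (a b c d : Fin q) (h1 : ¬ (a = c ∧ b = d)) (h2 : ¬ (a = d ∧ b = c)) :
    M (a, b) (c, d) = 0 := by
  have key : ∀ i : Fin q, (if a = i then Complex.I else 1) * (if b = i then Complex.I else 1)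
      * M (a, b) (c, d) = M (a, b) (c, d) *
      ((if c = i then Complex.I else 1) * (if d = i then Complex.I else 1)) := by
    intro i
    have h := congrFun (congrFun (hM _ (tw_diag_mem i)) (a, b)) (c, d)
    rw [Matrix.diagonal_kronecker_diagonal, Matrix.diagonal_mul, Matrix.mul_diagonal] at h
    exact h
  have hI1 : Complex.I ≠ 1 := by simp [Complex.ext_iff]
  have hII : Complex.I * Complex.I ≠ 1 := by rw [Complex.I_mul_I]; norm_num
  have hI2 : Complex.I * Complex.I ≠ Complex.I := by simp [Complex.ext_iff]
  by_contra hne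
  have key2 : ∀ i : Fin q, (if a = i then Complex.I else 1) * (if b = i then Complex.I else 1)
      = ((if c = i then Complex.I else 1) * (if d = i then Complex.I else 1)) := by
    intro i
    have := key i
    rw [mul_comm] at this
    exact mul_left_cancel₀ hne this
  have ka := key2 a
  have kb := key2 b
  grind

lemma tw_had {q : ℕ} {M : Matrix (Fin q × Fin q) (Fin q × Fin q) ℂ} (hM : TwComm M)
    (i j : Fin q) (hij : i ≠ j) :
    M (i, j) (i, j) + M (j, i) (i, j) = M (i, i) (i, i) := by
  have hm := tw_refl_mem (q := q) (fun a => if a = i then 1 else if a = j then 2 else 0) (2 / 5)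
    (by ext a; simp only [Pi.star_apply]; split_ifs <;> simp) (by simp)
    (by
      have : ((fun a => if a = i then (1 : ℂ) else if a = j then 2 else 0) ⬝ᵥ
        (fun a => if a = i then (1 : ℂ) else if a = j then 2 else 0)) = 5 := by
        unfold dotProduct
        rw [Fintype.sum_eq_add i j hij]
        · simp [hij.symm]; norm_num
        · rintro x ⟨h1, h2⟩
          simp [h1, h2]
      rw [this]; norm_num)
  have h := congrFun (congrFun (hM _ hm) (i, i)) (i, j)
  rw [Matrix.mul_apply, Matrix.mul_apply, Fintype.sum_eq_add (i, j) (j, i) (by simp [hij]),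
    Fintype.sum_eq_single (i, i)] at h
  · simp [Matrix.kroneckerMap_apply, Matrix.vecMulVec_apply, hij, hij.symm] at h
    linear_combination (-25 / 12 : ℂ) * h
  · rintro ⟨x, y⟩ hb
    rw [tw_zero hM, zero_mul] <;> grind
  · rintro ⟨x, y⟩ ⟨hb, hb'⟩
    rw [tw_zero hM, mul_zero] <;> grind

lemma tw_exists_perm {q : ℕ} (i j a b : Fin q) (hij : i ≠ j) (hab : a ≠ b) :
    ∃ σ : Equiv.Perm (Fin q), σ i = a ∧ σ j = b := by
  refine ⟨Equiv.swap (Equiv.swap i a j) b * Equiv.swap i a, ?_, ?_⟩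
  · rw [Equiv.Perm.mul_apply, Equiv.swap_apply_left, Equiv.swap_apply_of_ne_of_ne _ hab]
    intro h
    apply hij
    apply (Equiv.swap i a).injective
    rw [← h, Equiv.swap_apply_left]
  · simp

lemma tw_commutant {q : ℕ} (hq : 2 ≤ q) {M : Matrix (Fin q × Fin q) (Fin q × Fin q) ℂ}
    (hM : TwComm M) : ∃ α β : ℂ, M = α • (1 : Matrix (Fin q × Fin q) (Fin q × Fin q) ℂ)
      + β • swapOp q := by
  let i : Fin q := ⟨0, by omega⟩
  let j : Fin q := ⟨1, by omega⟩
  have hij : i ≠ j := by simp [i, j]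
  refine ⟨M (i, j) (i, j), M (j, i) (i, j), ?_⟩
  have A : ∀ a b, a ≠ b → M (a, b) (a, b) = M (i, j) (i, j) := by
    intro a b hab
    obtain ⟨σ, rfl, rfl⟩ := tw_exists_perm i j a b hij hab
    exact tw_perm hM σ _ _ _ _
  have B : ∀ a b, a ≠ b → M (b, a) (a, b) = M (j, i) (i, j) := by
    intro a b hab
    obtain ⟨σ, rfl, rfl⟩ := tw_exists_perm i j a b hij hab
    exact tw_perm hM σ _ _ _ _
  have C : ∀ a, M (a, a) (a, a) = M (i, j) (i, j) + M (j, i) (i, j) := by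
    intro a
    obtain ⟨b, hb⟩ : ∃ b, a ≠ b := by
      by_cases h : a = i
      · exact ⟨j, h ▸ hij⟩
      · exact ⟨i, h⟩
    rw [← tw_had hM a b hb, A a b hb, B a b hb]
  ext ⟨a, b⟩ ⟨c, d⟩
  simp only [Matrix.add_apply, Matrix.smul_apply, tw_swap_apply, Matrix.one_apply, Prod.swap,
    Prod.mk.injEq, smul_eq_mul]
  by_cases h1 : a = c ∧ b = d
  · obtain ⟨rfl, rfl⟩ := h1
    by_cases h2 : a = b
    · subst h2; simp [C]
    · simp [A a b h2, h2]
  · by_cases h2 : a = d ∧ b = c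
    · obtain ⟨rfl, rfl⟩ := h2
      have : b ≠ a := by rintro rfl; simp at h1
      rw [B b a this]
      simp [this]
    · rw [tw_zero hM _ _ _ _ h1 h2, if_neg h1, if_neg h2]; simp

lemma tw_meas_entry {q : ℕ} (a b : Fin q) :
    Measurable (fun U : Matrix.unitaryGroup (Fin q) ℂ => (U : Matrix (Fin q) (Fin q) ℂ) a b) :=
  (measurable_pi_apply b).comp ((measurable_pi_apply a).comp measurable_subtype_coe)

lemma tw_meas_mul {q : ℕ} (V : Matrix.unitaryGroup (Fin q) ℂ) :
    Measurable (fun U : Matrix.unitaryGroup (Fin q) ℂ => V * U) := by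
  refine Measurable.subtype_mk ?_
  refine measurable_pi_lambda _ fun a => measurable_pi_lambda _ fun b => ?_
  simp only [Matrix.mul_apply]
  exact Finset.measurable_sum _ fun k _ => (tw_meas_entry k b).const_mul _

def twF {q : ℕ} (X : Matrix (Fin q × Fin q) (Fin q × Fin q) ℂ)
    (U : Matrix.unitaryGroup (Fin q) ℂ) : Matrix (Fin q × Fin q) (Fin q × Fin q) ℂ :=
  ((U : Matrix (Fin q) (Fin q) ℂ) ⊗ₖ (U : Matrix (Fin q) (Fin q) ℂ)) * X *
        ((U : Matrix (Fin q) (Fin q) ℂ) ⊗ₖ (U : Matrix (Fin q) (Fin q) ℂ))ᴴ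

lemma tw_integrable {q : ℕ} (μ : Measure (Matrix.unitaryGroup (Fin q) ℂ)) [IsProbabilityMeasure μ]
    (X : Matrix (Fin q × Fin q) (Fin q × Fin q) ℂ) (p r : Fin q × Fin q) :
    Integrable (fun U => twF X U p r) μ := by
  simp only [twF, Matrix.mul_apply, Finset.sum_mul, Matrix.conjTranspose_apply,
    Matrix.kroneckerMap_apply]
  refine integrable_finsetSum _ fun y _ => integrable_finsetSum _ fun x _ => ?_
  refine Integrable.of_bound (C := ‖X x y‖) ?_ ?_
  · have h1 := tw_meas_entry p.1 x.1
    have h2 := tw_meas_entry p.2 x.2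
    have h3 := tw_meas_entry r.1 y.1
    have h4 := tw_meas_entry r.2 y.2
    exact (((h1.mul h2).mul_const _).mul (continuous_star.measurable.comp (h3.mul h4))).aestronglyMeasurable
  · refine Filter.Eventually.of_forall fun U => ?_
    have h := entry_norm_bound_of_unitary U.2
    simp only [norm_mul, norm_star]
    have e1 := mul_le_one₀ (h p.1 x.1) (norm_nonneg _) (h p.2 x.2)
    have e2 := mul_le_one₀ (h r.1 y.1) (norm_nonneg _) (h r.2 y.2)
    calc _ ≤ 1 * ‖X x y‖ * 1 := by gcongr
      _ = _ := by ring

lemma tw_integral_mul {q : ℕ} (μ : Measure (Matrix.unitaryGroup (Fin q) ℂ))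
    [IsProbabilityMeasure μ]
    (X A B : Matrix (Fin q × Fin q) (Fin q × Fin q) ℂ) (p r : Fin q × Fin q) :
    ∫ U, (A * twF X U * B) p r ∂μ = (A * (Matrix.of fun p r => ∫ U, twF X U p r ∂μ) * B) p r := by
  simp only [Matrix.mul_apply, Finset.sum_mul, Matrix.of_apply]
  have hi : ∀ x y, Integrable (fun U => A p x * twF X U x y * B y r) μ := fun x y =>
    ((tw_integrable μ X x y).const_mul _).mul_const _
  rw [integral_finsetSum _ fun y _ => integrable_finsetSum _ fun x _ => hi x y]
  refine Finset.sum_congr rfl fun y _ => ?_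
  rw [integral_finsetSum _ fun x _ => hi x y]
  refine Finset.sum_congr rfl fun x _ => ?_
  rw [integral_mul_const, integral_const_mul]

lemma tw_unit {q : ℕ} (U : Matrix (Fin q) (Fin q) ℂ) (hU : U ∈ Matrix.unitaryGroup (Fin q) ℂ) :
    (U ⊗ₖ U)ᴴ * (U ⊗ₖ U) = 1 := by
  rw [Matrix.conjTranspose_kronecker, ← Matrix.mul_kronecker_mul, ← Matrix.star_eq_conjTranspose,
    Matrix.mem_unitaryGroup_iff'.1 hU, Matrix.one_kronecker_one]

lemma tw_trace_mul {q : ℕ} (μ : Measure (Matrix.unitaryGroup (Fin q) ℂ))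
    [IsProbabilityMeasure μ]
    (X A : Matrix (Fin q × Fin q) (Fin q × Fin q) ℂ)
    (hA : ∀ U : Matrix (Fin q) (Fin q) ℂ, A * (U ⊗ₖ U) = (U ⊗ₖ U) * A) :
    Matrix.trace (A * (Matrix.of fun p r => ∫ U, twF X U p r ∂μ)) = Matrix.trace (A * X) := by
  have h : ∀ U, Matrix.trace (A * twF X U * 1) = Matrix.trace (A * X) := by
    intro U
    rw [mul_one, twF, ← mul_assoc, ← mul_assoc, hA, Matrix.trace_mul_comm, ← mul_assoc,
      ← mul_assoc, tw_unit _ U.2, one_mul]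
  have h2 : ∫ U, Matrix.trace (A * twF X U * 1) ∂μ = Matrix.trace (A * X) := by
    simp only [h]
    simp
  rw [← h2, ← mul_one (A * Matrix.of _)]
  simp only [Matrix.trace, Matrix.diag_apply]
  rw [integral_finsetSum]
  · exact Finset.sum_congr rfl fun x _ => (tw_integral_mul μ X A 1 x x).symm
  · intro x _
    have e : (fun U : Matrix.unitaryGroup (Fin q) ℂ => (A * twF X U * (1 : Matrix (Fin q × Fin q) (Fin q × Fin q) ℂ)) x x) = fun U => ∑ y, A x y * twF X U y x := by
      funext U
      rw [mul_one, Matrix.mul_apply]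
    rw [e]
    exact integrable_finsetSum _ fun y _ => (tw_integrable μ X y x).const_mul (A x y)

lemma tw_comm {q : ℕ} (μ : Measure (Matrix.unitaryGroup (Fin q) ℂ)) [IsProbabilityMeasure μ]
    (hHaar : ∀ V : Matrix.unitaryGroup (Fin q) ℂ, μ.map (fun U => V * U) = μ)
    (X : Matrix (Fin q × Fin q) (Fin q × Fin q) ℂ) :
    TwComm (Matrix.of fun p r => ∫ U, twF X U p r ∂μ) := by
  intro V hV
  have h : (V ⊗ₖ V) * (Matrix.of fun p r => ∫ U, twF X U p r ∂μ) * (V ⊗ₖ V)ᴴ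
      = (Matrix.of fun p r => ∫ U, twF X U p r ∂μ) := by
    ext p r
    rw [← tw_integral_mul, Matrix.of_apply]
    conv_rhs => rw [← hHaar ⟨V, hV⟩]
    rw [integral_map (tw_meas_mul _).aemeasurable]
    · refine integral_congr_ae (Filter.Eventually.of_forall fun U => ?_)
      simp only [twF]
      rw [show ((⟨V, hV⟩ * U : Matrix.unitaryGroup (Fin q) ℂ) : Matrix (Fin q) (Fin q) ℂ)
        = V * (U : Matrix (Fin q) (Fin q) ℂ) from rfl, Matrix.mul_kronecker_mul,
        Matrix.conjTranspose_mul]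
      simp only [mul_assoc]
    · rw [hHaar]
      exact (tw_integrable μ X p r).aestronglyMeasurable
  conv_rhs => rw [← h]
  rw [mul_assoc _ _ (V ⊗ₖ V), tw_unit V hV, mul_one]

/-- second-order Weingarten calculus (two-fold twirl formula).  For `U`
Haar-distributed on `U(q)` (the Haar measure being the unique left-invariant Borel
probability measure on the unitary group) and any `X ∈ M_{q²}(ℂ)`,
`E[(U ⊗ U) X (U ⊗ U)†] = ((Tr X − Tr(𝔽X)/q)/(q²−1))·1 + ((Tr(𝔽X) − Tr(X)/q)/(q²−1))·𝔽`,
stated entrywise. -/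
theorem twofold_twirl
    (q : ℕ) (hq : 2 ≤ q)
    (μ : Measure (Matrix.unitaryGroup (Fin q) ℂ)) [IsProbabilityMeasure μ]
    (hHaar : ∀ V : Matrix.unitaryGroup (Fin q) ℂ, μ.map (fun U => V * U) = μ)
    (X : Matrix (Fin q × Fin q) (Fin q × Fin q) ℂ) (p r : Fin q × Fin q) :
    ∫ U, (((U : Matrix (Fin q) (Fin q) ℂ) ⊗ₖ (U : Matrix (Fin q) (Fin q) ℂ)) * X *
        ((U : Matrix (Fin q) (Fin q) ℂ) ⊗ₖ (U : Matrix (Fin q) (Fin q) ℂ))ᴴ) p r ∂μ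
      = (((Matrix.trace X - Matrix.trace (swapOp q * X) / q) / ((q : ℂ) ^ 2 - 1)) •
            (1 : Matrix (Fin q × Fin q) (Fin q × Fin q) ℂ)
          + ((Matrix.trace (swapOp q * X) - Matrix.trace X / q) / ((q : ℂ) ^ 2 - 1)) •
            swapOp q) p r := by
  obtain ⟨α, β, h⟩ := tw_commutant hq (tw_comm μ hHaar X)
  have t1 := tw_trace_mul μ X 1 (fun U => by simp)
  have t2 := tw_trace_mul μ X (swapOp q) (fun U => tw_swap_comm U)
  have hs : Matrix.trace (swapOp q) = q := by
    simp only [Matrix.trace, Matrix.diag_apply, tw_swap_apply, Fintype.sum_prod_type, Prod.swap,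
      Prod.mk.injEq]
    have : ∀ x y : Fin q, (if x = y ∧ y = x then (1 : ℂ) else 0) = if x = y then 1 else 0 := by
      intro x y
      by_cases hxy : x = y <;> simp [hxy]
    simp [this]
  have hss : swapOp q * swapOp q = 1 := by
    ext p r
    rw [tw_swap_mul, tw_swap_apply, Matrix.one_apply]
    simp [Prod.swap_inj]
  have h1 : Matrix.trace (1 : Matrix (Fin q × Fin q) (Fin q × Fin q) ℂ) = (q : ℂ) ^ 2 := by
    simp [Matrix.trace_one, sq]
  rw [h] at t1 t2
  rw [one_mul, one_mul, Matrix.trace_add, Matrix.trace_smul, Matrix.trace_smul, hs, h1] at t1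
  rw [mul_add, Matrix.mul_smul, Matrix.mul_smul, hss, mul_one, Matrix.trace_add,
    Matrix.trace_smul, Matrix.trace_smul, hs, h1] at t2
  simp only [smul_eq_mul] at t1 t2
  have hq0 : (q : ℂ) ≠ 0 := by
    norm_cast
    omega
  have hq1 : (q : ℂ) ^ 2 - 1 ≠ 0 := by
    rw [sub_ne_zero]
    norm_cast
    nlinarith
  have e := congrFun (congrFun h p) r
  rw [Matrix.of_apply] at e
  simp only [twF] at e
  have ea : (Matrix.trace X - Matrix.trace (swapOp q * X) / q) / ((q : ℂ) ^ 2 - 1) = α := by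
    rw [← t1, ← t2, div_eq_iff hq1]
    field_simp
    ring
  have eb : (Matrix.trace (swapOp q * X) - Matrix.trace X / q) / ((q : ℂ) ^ 2 - 1) = β := by
    rw [← t1, ← t2, div_eq_iff hq1]
    field_simp
    ring
  rw [e, ea, eb]
end
end
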